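/- Let f ∈ 𝓑 with Taylor coefficients a_n and let 0 ≤ r ≤ 1/3. If r ≤ |a₀| ≤ 1, then Σ_{n=0}^∞ |a_n| r^n + (1 − |a₀| − r(1−|a₀|²)/(1−|a₀|r)) ≤ 1. If 0 ≤ |a₀| < r, then Σ_{n=0}^∞ |a_n| r^n + (1 − |a₀| − r√(1−|a₀|²)/√(1−r²)) ≤ 1. Moreover, these inequalities are optimal in the sense that there is no λ > 1 such that Σ_{n=0}^∞ |a_n| r^n + λ·ψ(f,r) ≤ 1 for every f ∈ 𝓑 and every 0 ≤ r ≤ 1/3, where ψ(f,r) := Ψ(|f(0)|, r). -/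

import Mathlib

open Metric

/-- The `n`-th Taylor coefficient of `f` at `0`. -/
noncomputable def taylorCoeff (f : ℂ → ℂ) (n : ℕ) : ℂ :=
  iteratedDeriv n f 0 / n.factorial

/-- The class `𝓑` of holomorphic functions on the unit disc bounded by `1`. -/
def memB (f : ℂ → ℂ) : Prop :=
  DifferentiableOn ℂ f (ball (0 : ℂ) 1) ∧ ∀ z ∈ ball (0 : ℂ) 1, ‖f z‖ ≤ 1

/-- `Σ_{n≥0} |aₙ| rⁿ`, the Bohr sum of `f` at radius `r`. -/
noncomputable def bohrSum (f : ℂ → ℂ) (r : ℝ) : ℝ :=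
  ∑' n : ℕ, ‖taylorCoeff f n‖ * r ^ n

/-- `Ψ(a,r) = 1 − a − r(1−a²)/(1−ar)` if `r ≤ a`, and
`Ψ(a,r) = 1 − a − r√(1−a²)/√(1−r²)` if `a < r`. -/
noncomputable def Psi (a r : ℝ) : ℝ :=
  if r ≤ a then 1 - a - r * (1 - a ^ 2) / (1 - a * r)
  else 1 - a - r * Real.sqrt (1 - a ^ 2) / Real.sqrt (1 - r ^ 2)


lemma le_of_sqs {x y : ℝ} (h : x ^ 2 ≤ y ^ 2) (hy : 0 ≤ y) : x ≤ y :=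
  (le_abs_self x).trans (abs_le_of_sq_le_sq h hy)

lemma parseval_aux (c : ℕ → ℂ) (hc : Summable (fun n => ‖c n‖)) :
    ∃ F : C(UnitAddCircle, ℂ),
      (∀ x : UnitAddCircle, HasSum (fun n => c n * ((AddCircle.toCircle x : Circle) : ℂ) ^ n) (F x)) ∧
      HasSum (fun n => ‖c n‖ ^ 2)
        (‖ContinuousMap.toLp (E := ℂ) 2 (AddCircle.haarAddCircle (T := (1:ℝ))) ℂ F‖ ^ 2) := by
  have hs : Summable (fun n : ℕ => c n • (fourier (n : ℤ) : C(UnitAddCircle, ℂ))) := by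
    apply Summable.of_norm
    simpa [norm_smul, fourier_norm] using hc
  obtain ⟨F, hF⟩ := hs
  refine ⟨F, fun x => ?_, ?_⟩
  · have h1 := (ContinuousMap.evalCLM ℂ x : C(UnitAddCircle, ℂ) →L[ℂ] ℂ).hasSum hF
    have h2 : HasSum (fun n => c n * ((AddCircle.toCircle x : Circle) : ℂ) ^ n)
        ((ContinuousMap.evalCLM ℂ x : C(UnitAddCircle, ℂ) →L[ℂ] ℂ) F) := by
      convert h1 using 2 with n
      simp [fourier_apply, AddCircle.toCircle_nsmul]
    exact h2
  · have h1 := (ContinuousMap.toLp (E := ℂ) 2 (AddCircle.haarAddCircle (T := (1:ℝ))) ℂ).hasSum hF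
    have h2 := (h1.norm).pow 2
    refine h2.congr fun S => ?_
    have ho : Orthonormal ℂ (fun n : ℕ => fourierLp (T := (1:ℝ)) 2 (n : ℤ)) :=
      (orthonormal_fourier (T := (1:ℝ))).comp _ Nat.cast_injective
    have h3 := ho.inner_sum c c S
    have h4 : (‖∑ i ∈ S, c i • fourierLp (T := (1:ℝ)) 2 (i : ℤ)‖ : ℂ) ^ 2
        = ((∑ i ∈ S, ‖c i‖ ^ 2 : ℝ) : ℂ) := by
      have h6 := inner_self_eq_norm_sq_to_K (𝕜 := ℂ)
        (∑ i ∈ S, c i • fourierLp (T := (1:ℝ)) 2 (i : ℤ))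
      refine (h6.symm.trans h3).trans ?_
      push_cast
      refine Finset.sum_congr rfl fun i _ => ?_
      rw [Complex.conj_mul']
    have h5 : ‖∑ i ∈ S, c i • fourierLp (T := (1:ℝ)) 2 (i : ℤ)‖ ^ 2
        = ∑ i ∈ S, ‖c i‖ ^ 2 := by exact_mod_cast h4
    simpa [map_smul] using h5

lemma subord_aux (b c : ℕ → ℂ) (hb : Summable (fun n => ‖b n‖)) (hc : Summable (fun n => ‖c n‖))
    (s : ℝ) (hs : 0 ≤ s)
    (h : ∀ u : ℂ, ‖u‖ = 1 → ∀ p q, HasSum (fun n => b n * u ^ n) p →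
      HasSum (fun n => c n * u ^ n) q → ‖p‖ ≤ s * ‖q‖) :
    ∃ B C : ℝ, HasSum (fun n => ‖b n‖ ^ 2) B ∧ HasSum (fun n => ‖c n‖ ^ 2) C ∧ B ≤ s ^ 2 * C := by
  obtain ⟨F, hF, hF2⟩ := parseval_aux b hb
  obtain ⟨G, hG, hG2⟩ := parseval_aux c hc
  refine ⟨_, _, hF2, hG2, ?_⟩
  rw [← mul_pow]
  refine pow_le_pow_left₀ (norm_nonneg _) ?_ 2
  apply MeasureTheory.Lp.norm_le_mul_norm_of_ae_le_mul
  filter_upwards [ContinuousMap.coeFn_toLp (𝕜 := ℂ) (p := 2) (AddCircle.haarAddCircle (T := (1:ℝ))) F,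
    ContinuousMap.coeFn_toLp (𝕜 := ℂ) (p := 2) (AddCircle.haarAddCircle (T := (1:ℝ))) G] with x h1 h2
  rw [h1, h2]
  exact h _ (Circle.norm_coe _) _ _ (hF x) (hG x)

lemma normSq_id (w α : ℂ) : ‖1 - (starRingEnd ℂ) α * w‖ ^ 2 - ‖w - α‖ ^ 2
    = (1 - ‖w‖ ^ 2) * (1 - ‖α‖ ^ 2) := by
  simp only [← Complex.normSq_eq_norm_sq, Complex.normSq_apply]
  simp
  ring

lemma schwarz_pick_strict (f : ℂ → ℂ) (hd : DifferentiableOn ℂ f (ball (0 : ℂ) 1))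
    (hf : ∀ z ∈ ball (0 : ℂ) 1, ‖f z‖ < 1) (z : ℂ) (hz : z ∈ ball (0 : ℂ) 1) :
    ‖f z - f 0‖ ≤ ‖z‖ * ‖1 - (starRingEnd ℂ) (f 0) * f z‖ := by
  have h0 : ‖f 0‖ < 1 := hf 0 (by simp)
  have hne : ∀ w ∈ ball (0 : ℂ) 1, 1 - (starRingEnd ℂ) (f 0) * f w ≠ 0 := by
    intro w hw he
    have h1 := sub_eq_zero.1 he
    have h2 : ‖(starRingEnd ℂ) (f 0) * f w‖ < 1 := by
      rw [norm_mul, RCLike.norm_conj]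
      exact mul_lt_one_of_nonneg_of_lt_one_left (norm_nonneg _) h0 (hf w hw).le
    rw [← h1] at h2
    simp at h2
  have key := Complex.norm_le_norm_of_mapsTo_ball (R := 1) (z := z)
    (f := fun w => (f w - f 0) / (1 - (starRingEnd ℂ) (f 0) * f w))
    ((hd.sub_const _).div ((hd.const_mul _).const_sub _) hne) ?_ (by simp) (by simpa using hz)
  · simp only [norm_div] at key
    rwa [div_le_iff₀ (norm_pos_iff.2 (hne z hz))] at key
  · intro w hw
    simp only [mem_closedBall, dist_zero_right, norm_div]
    rw [div_le_one (norm_pos_iff.2 (hne w hw))]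
    refine le_of_sqs ?_ (norm_nonneg _)
    have h1 := normSq_id (f w) (f 0)
    have h2 : ‖f w‖ ^ 2 ≤ 1 := pow_le_one₀ (norm_nonneg _) (hf w hw).le
    have h3 : ‖f 0‖ ^ 2 ≤ 1 := pow_le_one₀ (norm_nonneg _) h0.le
    nlinarith [mul_nonneg (sub_nonneg.2 h2) (sub_nonneg.2 h3)]

lemma schwarz_pick (f : ℂ → ℂ) (hf : memB f) (z : ℂ) (hz : z ∈ ball (0 : ℂ) 1) :
    ‖f z - f 0‖ ≤ ‖z‖ * ‖1 - (starRingEnd ℂ) (f 0) * f z‖ := by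
  have h1 : ∀ t ∈ Set.Ioo (0 : ℝ) 1, ‖(t : ℂ) * f z - t * f 0‖ ≤
      ‖z‖ * ‖1 - (starRingEnd ℂ) (t * f 0) * (t * f z)‖ := by
    intro t ht
    refine schwarz_pick_strict (fun w => t * f w) (hf.1.const_mul _) (fun w hw => ?_) z hz
    rw [norm_mul, Complex.norm_real, Real.norm_of_nonneg ht.1.le]
    exact mul_lt_one_of_nonneg_of_lt_one_left ht.1.le ht.2 (hf.2 w hw)
  have h2 := ContinuousWithinAt.closure_le (s := Set.Ioo (0:ℝ) 1) (x := 1)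
    (f := fun t : ℝ => ‖(t : ℂ) * f z - t * f 0‖)
    (g := fun t : ℝ => ‖z‖ * ‖1 - (starRingEnd ℂ) (t * f 0) * (t * f z)‖)
    (by rw [closure_Ioo (by norm_num)]; simp) (by apply Continuous.continuousWithinAt; fun_prop)
    (by simp only [map_mul, Complex.conj_ofReal]
        apply Continuous.continuousWithinAt; fun_prop) h1
  simpa using h2

lemma coeff_aux (f : ℂ → ℂ) (hf : memB f) (a : ℕ → ℂ)
    (ha : ∀ z ∈ ball (0 : ℂ) 1, HasSum (fun n : ℕ => a n * z ^ n) (f z)) (h0 : f 0 = a 0)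
    (s : ℝ) (hs : 0 ≤ s) (hs1 : s < 1) (N : ℕ) :
    (∑ n ∈ Finset.range N, (‖a (n + 1)‖ * s ^ (n + 1)) ^ 2) * (1 - ‖a 0‖ ^ 2 * s ^ 2)
      ≤ s ^ 2 * (1 - ‖a 0‖ ^ 2) ^ 2 := by
  have hsu : Summable (fun n => ‖a n * (s : ℂ) ^ n‖) :=
    (ha s (by simpa [abs_of_nonneg hs] using hs1)).summable.norm
  have hite : ∀ x : ℂ, HasSum (fun n : ℕ => if n = 0 then x else 0) x := fun x => hasSum_ite_eq 0 x
  have hA1 : ‖a 0‖ ≤ 1 := h0 ▸ hf.2 0 (by simp)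
  obtain ⟨B, C, hB, hC, hBC⟩ := subord_aux (fun n => a n * (s : ℂ) ^ n - if n = 0 then a 0 else 0)
    (fun n => (if n = 0 then 1 else 0) - (starRingEnd ℂ) (a 0) * (a n * (s : ℂ) ^ n))
    ((hsu.of_norm.sub (hite _).summable).norm)
    (((hite _).summable.sub (hsu.of_norm.mul_left _)).norm) s hs (by
      intro u hu p q hp hq
      have hz : (s : ℂ) * u ∈ ball (0 : ℂ) 1 := by simpa [hu, abs_of_nonneg hs] using hs1
      have h := ha _ hz
      have hp' : HasSum (fun n => (a n * (s : ℂ) ^ n - if n = 0 then a 0 else 0) * u ^ n)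
          (f (s * u) - a 0) := by
        refine (h.sub (hite (a 0))).congr_fun ?_
        intro n
        rcases eq_or_ne n 0 with rfl | hn
        · simp
        · simp [hn, mul_pow, mul_assoc]
      have hq' : HasSum (fun n => ((if n = 0 then 1 else 0)
          - (starRingEnd ℂ) (a 0) * (a n * (s : ℂ) ^ n)) * u ^ n)
          (1 - (starRingEnd ℂ) (a 0) * f (s * u)) := by
        refine ((hite 1).sub (h.mul_left ((starRingEnd ℂ) (a 0)))).congr_fun ?_
        intro n
        rcases eq_or_ne n 0 with rfl | hn
        · simp
        · simp [hn, mul_pow, mul_assoc]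
      rw [hp.unique hp', hq.unique hq']
      have := schwarz_pick f hf _ hz
      rw [h0] at this
      simpa [hu, abs_of_nonneg hs] using this)
  have hC' : HasSum (fun n : ℕ => ‖(if n = 0 then 1 else 0)
      - (starRingEnd ℂ) (a 0) * (a n * (s : ℂ) ^ n)‖ ^ 2)
      ((1 - ‖a 0‖ ^ 2) ^ 2 + ‖a 0‖ ^ 2 * B) := by
    refine ((hasSum_ite_eq 0 ((1 - ‖a 0‖ ^ 2) ^ 2)).add (hB.mul_left (‖a 0‖ ^ 2))).congr_fun ?_
    intro n
    rcases eq_or_ne n 0 with rfl | hn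
    · simp [Complex.conj_mul']
      norm_cast
      simp
    · simp [hn]
      ring
  have hCe := hC.unique hC'
  have hfin : ∑ n ∈ Finset.range N, (‖a (n + 1)‖ * s ^ (n + 1)) ^ 2 ≤ B := by
    have := sum_le_hasSum (Finset.range (N + 1)) (fun i _ => by positivity) hB
    rw [Finset.sum_range_succ'] at this
    simpa [abs_of_nonneg hs] using this
  have h1 : 0 ≤ 1 - ‖a 0‖ ^ 2 * s ^ 2 := by
    have := mul_le_one₀ (pow_le_one₀ (n := 2) (norm_nonneg _) hA1) (by positivity)
      (pow_le_one₀ (n := 2) hs hs1.le)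
    linarith
  calc _ ≤ B * (1 - ‖a 0‖ ^ 2 * s ^ 2) := mul_le_mul_of_nonneg_right hfin h1
    _ ≤ _ := by rw [hCe] at hBC; linarith

lemma coeff_aux' (f : ℂ → ℂ) (hf : memB f) (a : ℕ → ℂ)
    (ha : ∀ z ∈ ball (0 : ℂ) 1, HasSum (fun n : ℕ => a n * z ^ n) (f z)) (h0 : f 0 = a 0)
    (s : ℝ) (hs : 0 ≤ s) (hs1 : s ≤ 1) (N : ℕ) :
    (∑ n ∈ Finset.range N, (‖a (n + 1)‖ * s ^ (n + 1)) ^ 2) * (1 - ‖a 0‖ ^ 2 * s ^ 2)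
      ≤ s ^ 2 * (1 - ‖a 0‖ ^ 2) ^ 2 := by
  refine ContinuousWithinAt.closure_le (s := Set.Ioo (0:ℝ) 1) (x := s)
    (f := fun s : ℝ => (∑ n ∈ Finset.range N, (‖a (n + 1)‖ * s ^ (n + 1)) ^ 2)
      * (1 - ‖a 0‖ ^ 2 * s ^ 2))
    (g := fun s : ℝ => s ^ 2 * (1 - ‖a 0‖ ^ 2) ^ 2)
    (by rw [closure_Ioo (by norm_num)]; exact ⟨hs, hs1⟩)
    (by apply Continuous.continuousWithinAt; fun_prop)
    (by apply Continuous.continuousWithinAt; fun_prop)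
    (fun s h => coeff_aux f hf a ha h0 s h.1.le h.2 N)

lemma geom_aux (q : ℝ) (h0 : 0 ≤ q) (N : ℕ) :
    (∑ n ∈ Finset.range N, (q ^ (n + 1)) ^ 2) * (1 - q ^ 2) ≤ q ^ 2 := by
  have h : (∑ n ∈ Finset.range N, (q ^ (n + 1)) ^ 2) * (1 - q ^ 2)
      = q ^ 2 - (q ^ (N + 1)) ^ 2 := by
    induction N with
    | zero => simp
    | succ k ih => rw [Finset.sum_range_succ, add_mul, ih]; ring
  rw [h]
  have : 0 ≤ (q ^ (N + 1)) ^ 2 := by positivity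
  linarith

lemma bohr_aux (f : ℂ → ℂ) (hf : memB f) (a : ℕ → ℂ)
    (ha : ∀ z ∈ ball (0 : ℂ) 1, HasSum (fun n : ℕ => a n * z ^ n) (f z)) (h0 : f 0 = a 0)
    (s t : ℝ) (hs : 0 ≤ s) (hs1 : s ≤ 1) (ht : 0 ≤ t) (ht1 : t < 1)
    (hst : 0 ≤ 1 - ‖a 0‖ ^ 2 * s ^ 2) (N : ℕ) :
    (∑ n ∈ Finset.range N, ‖a (n + 1)‖ * (s * t) ^ (n + 1)) ^ 2
      * ((1 - ‖a 0‖ ^ 2 * s ^ 2) * (1 - t ^ 2)) ≤ (s * t * (1 - ‖a 0‖ ^ 2)) ^ 2 := by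
  have h1 := coeff_aux' f hf a ha h0 s hs hs1 N
  have h2 := geom_aux t ht N
  have h3 := Finset.sum_mul_sq_le_sq_mul_sq (Finset.range N)
    (fun n => ‖a (n + 1)‖ * s ^ (n + 1)) (fun n => t ^ (n + 1))
  have h4 : 0 ≤ 1 - t ^ 2 := by nlinarith
  have h5 : ∑ n ∈ Finset.range N, ‖a (n + 1)‖ * (s * t) ^ (n + 1)
      = ∑ n ∈ Finset.range N, ‖a (n + 1)‖ * s ^ (n + 1) * t ^ (n + 1) :=
    Finset.sum_congr rfl fun n _ => by ring
  rw [h5]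
  calc _ ≤ _ := mul_le_mul_of_nonneg_right h3 (mul_nonneg hst h4)
    _ = ((∑ n ∈ Finset.range N, (‖a (n + 1)‖ * s ^ (n + 1)) ^ 2) * (1 - ‖a 0‖ ^ 2 * s ^ 2)) *
        ((∑ n ∈ Finset.range N, (t ^ (n + 1)) ^ 2) * (1 - t ^ 2)) := by ring
    _ ≤ (s ^ 2 * (1 - ‖a 0‖ ^ 2) ^ 2) * t ^ 2 := by
        refine mul_le_mul h1 h2 (mul_nonneg (Finset.sum_nonneg fun i _ => by positivity) h4)
          (by positivity)
    _ = _ := by ring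

lemma tsum_aux (a : ℕ → ℂ) (r K : ℝ) (hr : 0 ≤ r)
    (h : ∀ N, ∑ n ∈ Finset.range N, ‖a (n + 1)‖ * r ^ (n + 1) ≤ K) :
    ∑' n : ℕ, ‖a n‖ * r ^ n ≤ ‖a 0‖ + K := by
  refine Real.tsum_le_of_sum_range_le (fun n => by positivity) fun N => ?_
  calc _ ≤ ∑ n ∈ Finset.range (N + 1), ‖a n‖ * r ^ n := by
        rw [Finset.sum_range_succ]
        have : 0 ≤ ‖a N‖ * r ^ N := by positivity
        linarith
    _ ≤ _ := by
        rw [Finset.sum_range_succ']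
        have := h N
        simp only [pow_zero, mul_one]
        linarith

/-- Strengthened Bohr inequality: for `f ∈ 𝓑` with Taylor coefficients `aₙ` and
`0 ≤ r ≤ 1/3`, if `r ≤ |a₀| ≤ 1` then
`Σ ‖aₙ‖ rⁿ + (1 − |a₀| − r(1−|a₀|²)/(1−|a₀|r)) ≤ 1`, and if `0 ≤ |a₀| < r` then
`Σ ‖aₙ‖ rⁿ + (1 − |a₀| − r√(1−|a₀|²)/√(1−r²)) ≤ 1`. Moreover these inequalities are
optimal: there is no `λ > 1` with `Σ ‖aₙ‖ rⁿ + λ ψ(f,r) ≤ 1` for every `f ∈ 𝓑` and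
every `0 ≤ r ≤ 1/3`, where `ψ(f,r) = Ψ(|f(0)|, r)`. -/
theorem bohr_strengthened_optimal :
    (∀ f : ℂ → ℂ, memB f →
      ∀ a : ℕ → ℂ,
        (∀ z ∈ ball (0 : ℂ) 1, HasSum (fun n : ℕ => a n * z ^ n) (f z)) →
      ∀ r : ℝ, 0 ≤ r → r ≤ 1 / 3 →
        (r ≤ ‖a 0‖ →
          (∑' n : ℕ, ‖a n‖ * r ^ n) +
            (1 - ‖a 0‖ - r * (1 - ‖a 0‖ ^ 2) / (1 - ‖a 0‖ * r)) ≤ 1) ∧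
        (‖a 0‖ < r →
          (∑' n : ℕ, ‖a n‖ * r ^ n) +
            (1 - ‖a 0‖ - r * Real.sqrt (1 - ‖a 0‖ ^ 2) / Real.sqrt (1 - r ^ 2)) ≤ 1)) ∧
    ¬ ∃ lam : ℝ, 1 < lam ∧
        ∀ f, memB f → ∀ r, 0 ≤ r → r ≤ 1 / 3 →
          bohrSum f r + lam * Psi ‖f 0‖ r ≤ 1 := by
  constructor
  · intro f hf a ha r hr hr3
    have h0 : f 0 = a 0 := by
      have h := ha 0 (by simp)
      refine h.unique ?_
      convert hasSum_ite_eq (0 : ℕ) (a 0) using 2 with n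
      rcases eq_or_ne n 0 with rfl | hn
      · simp
      · simp [hn]
    have hA1 : ‖a 0‖ ≤ 1 := h0 ▸ hf.2 0 (by simp)
    have hA0 : 0 ≤ ‖a 0‖ := norm_nonneg _
    constructor
    · intro hra
      suffices h : ∑' n : ℕ, ‖a n‖ * r ^ n ≤
          ‖a 0‖ + r * (1 - ‖a 0‖ ^ 2) / (1 - ‖a 0‖ * r) by linarith
      refine tsum_aux a r _ hr fun N => ?_
      rcases hr.eq_or_lt with rfl | hrpos
      · simp
      have hApos : 0 < ‖a 0‖ := hrpos.trans_le hra
      have har : ‖a 0‖ * r < 1 := by nlinarith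
      have hsq : Real.sqrt (r / ‖a 0‖) ^ 2 = r / ‖a 0‖ := Real.sq_sqrt (by positivity)
      have htq : Real.sqrt (r * ‖a 0‖) ^ 2 = r * ‖a 0‖ := Real.sq_sqrt (by positivity)
      have hst : Real.sqrt (r / ‖a 0‖) * Real.sqrt (r * ‖a 0‖) = r := by
        rw [← Real.sqrt_mul (by positivity)]
        have : r / ‖a 0‖ * (r * ‖a 0‖) = r ^ 2 := by field_simp
        rw [this, Real.sqrt_sq hr]
      have hAs : ‖a 0‖ ^ 2 * Real.sqrt (r / ‖a 0‖) ^ 2 = ‖a 0‖ * r := by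
        rw [hsq]; field_simp
      have h := bohr_aux f hf a ha h0 (Real.sqrt (r / ‖a 0‖)) (Real.sqrt (r * ‖a 0‖))
        (Real.sqrt_nonneg _) (Real.sqrt_le_one.2 ((div_le_one hApos).2 hra)) (Real.sqrt_nonneg _)
        (by rw [Real.sqrt_lt' one_pos]; linarith) (by rw [hAs]; linarith) N
      rw [hAs, htq, hst] at h
      rw [le_div_iff₀ (by linarith)]
      refine le_of_sqs ?_ (mul_nonneg hr (by nlinarith))
      calc _ = _ := by ring
        _ ≤ _ := h
    · intro har
      suffices h : ∑' n : ℕ, ‖a n‖ * r ^ n ≤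
          ‖a 0‖ + r * Real.sqrt (1 - ‖a 0‖ ^ 2) / Real.sqrt (1 - r ^ 2) by linarith
      refine tsum_aux a r _ hr fun N => ?_
      have hA2 : 0 < 1 - ‖a 0‖ ^ 2 := by nlinarith
      have hr2 : 0 < 1 - r ^ 2 := by nlinarith
      have h := bohr_aux f hf a ha h0 1 r zero_le_one le_rfl hr (by linarith) (by simpa using hA2.le) N
      simp only [one_mul, one_pow, mul_one] at h
      rw [le_div_iff₀ (Real.sqrt_pos.2 hr2)]
      refine le_of_sqs ?_ (by positivity)
      rw [mul_pow, mul_pow, Real.sq_sqrt hr2.le, Real.sq_sqrt hA2.le]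
      refine le_of_mul_le_mul_right ?_ hA2
      calc _ = _ := by ring
        _ ≤ _ := h
        _ = _ := by ring
  · rintro ⟨lam, hl, h⟩
    have h1 := h (fun _ => 0) ⟨by fun_prop, by simp⟩ 0 le_rfl (by norm_num)
    simp [bohrSum, taylorCoeff, Psi] at h1
    linarith
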